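/- arXiv:2309.02748 — 12 statements merged into one kernel-verified Lean document; each statement's English description precedes it below -/
import Mathlib

section
/- Let L be a language over a finite alphabet Σ accepted by a Boolean finite automaton with n states. Then L is accepted by a nondeterministic finite automaton with multiple initial states (MNFA) having exactly 2^n states whose reverse is deterministic, i.e., the MNFA has exactly one accepting state and for every state u and every symbol a there is exactly one state u' such that u lies in the step set of u' on a. -/
/-- A Boolean finite automaton (BFA): `δ` maps each state and symbol to a
Boolean function in the state variables, `g` is the initial Boolean function,
and `accept` is the finality (characteristic) vector of the final state set. -/
structure BFA (α : Type) (σ : Type) where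
  δ : σ → α → (σ → Bool) → Bool
  g : (σ → Bool) → Bool
  accept : σ → Bool

namespace BFA

variable {α σ : Type}

/-- One-symbol action on Boolean functions: `(h·a)(v) = h (fun q => δ q a v)`. -/
def stepFn (A : BFA α σ) (h : (σ → Bool) → Bool) (a : α) : (σ → Bool) → Bool :=
  fun v => h fun q => A.δ q a v

/-- Action of a string on the initial function: `g·ε = g`, `g·(wa) = (g·w)·a`. -/
def eval (A : BFA α σ) (w : List α) : (σ → Bool) → Bool :=
  w.foldl A.stepFn A.g

/-- The language of a BFA: strings whose resulting Boolean function
evaluates to `true` on the finality vector. -/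
def language (A : BFA α σ) : Language α :=
  { w | A.eval w A.accept = true }

/-- A BFA is alternating (an AFA) if its initial function is a projection. -/
def IsAFA (A : BFA α σ) : Prop :=
  ∃ q₀ : σ, A.g = fun v => v q₀

end BFA

/-- `L` is accepted by some `n`-state BFA. -/
def AcceptsBFA {α : Type} (L : Language α) (n : ℕ) : Prop :=
  ∃ (σ : Type) (_ : Fintype σ), Fintype.card σ = n ∧ ∃ A : BFA α σ, A.language = L

/-- `L` is accepted by some `n`-state AFA. -/
def AcceptsAFA {α : Type} (L : Language α) (n : ℕ) : Prop :=
  ∃ (σ : Type) (_ : Fintype σ), Fintype.card σ = n ∧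
    ∃ A : BFA α σ, A.IsAFA ∧ A.language = L

/-- `L` is accepted by some `n`-state DFA. -/
def AcceptsDFA {α : Type} (L : Language α) (n : ℕ) : Prop :=
  ∃ (σ : Type) (_ : Fintype σ), Fintype.card σ = n ∧ ∃ D : DFA α σ, D.accepts = L

/-- `L` is accepted by some `n`-state NFA with a unique initial state. -/
def AcceptsNFA1 {α : Type} (L : Language α) (n : ℕ) : Prop :=
  ∃ (σ : Type) (_ : Fintype σ), Fintype.card σ = n ∧
    ∃ (M : NFA α σ) (q₀ : σ), M.start = {q₀} ∧ M.accepts = L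

/-- The reversal of a language. -/
def Language.rev {α : Type} (L : Language α) : Language α :=
  { w | w.reverse ∈ L }

namespace BFA

variable {α σ : Type}

/-- The MNFA on valuations of the state variables of `A`: it steps from `v` to `u` on `a` exactly
when `v` is obtained from `u` by evaluating the transition functions on `a`. -/
def toNFA (A : BFA α σ) : NFA α (σ → Bool) where
  step v a := {u | (fun q => A.δ q a u) = v}
  start := {v | A.g v = true}
  accept := {A.accept}

theorem toNFA_stepSet (A : BFA α σ) (h : (σ → Bool) → Bool) (a : α) :
    A.toNFA.stepSet {v | h v = true} a = {u | A.stepFn h a u = true} := by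
  ext u
  simp [NFA.mem_stepSet, toNFA, stepFn]

theorem toNFA_evalFrom (A : BFA α σ) (h : (σ → Bool) → Bool) (w : List α) :
    A.toNFA.evalFrom {v | h v = true} w = {u | w.foldl A.stepFn h u = true} := by
  induction w generalizing h with
  | nil => rfl
  | cons a w ih => rw [NFA.evalFrom_cons, toNFA_stepSet, ih, List.foldl_cons]

theorem toNFA_accepts (A : BFA α σ) : A.toNFA.accepts = A.language := by
  ext w
  have hw : A.toNFA.eval w = {u | A.eval w u = true} := A.toNFA_evalFrom A.g w
  change (∃ v ∈ ({A.accept} : Set (σ → Bool)), v ∈ A.toNFA.eval w) ↔ A.eval w A.accept = true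
  simp [hw]

end BFA

/-- If `L` is accepted by an `n`-state BFA, then `L` is accepted by an MNFA with
exactly `2^n` states whose reverse is deterministic: it has exactly one
accepting state and for each state `u` and symbol `a` there is exactly one
state `u'` with `u ∈ M.step u' a`. -/
theorem bfa_to_mnfa_reverse_deterministic (α : Type) [Fintype α] (L : Language α) (n : ℕ)
    (h : AcceptsBFA L n) :
    ∃ (σ : Type) (_ : Fintype σ) (M : NFA α σ),
      Fintype.card σ = 2 ^ n ∧ M.accepts = L ∧
      (∃! f : σ, f ∈ M.accept) ∧
      ∀ (u : σ) (a : α), ∃! u' : σ, u ∈ M.step u' a := by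
  classical
  obtain ⟨σ, _, rfl, A, rfl⟩ := h
  refine ⟨σ → Bool, inferInstance, A.toNFA, by simp, A.toNFA_accepts, ?_, fun u a => ?_⟩
  · exact ⟨A.accept, rfl, fun _ hv => hv⟩
  · exact ⟨fun q => A.δ q a u, rfl, fun _ hv => Eq.symm hv⟩
end

section
/- If a language L over a finite alphabet Σ is accepted by a Boolean finite automaton with n states, then the reversal L^R is accepted by a deterministic finite automaton with exactly 2^n states. -/
namespace BFA

variable {α σ : Type}

/-- The DFA whose states are the valuations of the state variables of `A`. It reads words
backwards: a symbol `a` sends the valuation `v` to `fun q => A.δ q a v`. -/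
def reverseDFA (A : BFA α σ) : DFA α (σ → Bool) where
  step v a := fun q => A.δ q a v
  start := A.accept
  accept := { v | A.g v = true }

theorem eval_reverse (A : BFA α σ) (w : List α) (v : σ → Bool) :
    A.eval w.reverse v = A.g (A.reverseDFA.evalFrom v w) := by
  induction w generalizing v with
  | nil => rfl
  | cons a w ih =>
    rw [DFA.evalFrom_cons, ← ih]
    simp [eval, stepFn, reverseDFA]

theorem accepts_reverseDFA (A : BFA α σ) : A.reverseDFA.accepts = A.language.rev := by
  ext w
  change A.g (A.reverseDFA.evalFrom A.accept w) = true ↔ A.eval w.reverse A.accept = true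
  rw [eval_reverse]

end BFA

/-- If `L` is accepted by an `n`-state BFA, then `L^R` is accepted by a DFA
with exactly `2^n` states. -/
theorem bfa_to_dfa_reverse (α : Type) [Fintype α] (L : Language α) (n : ℕ)
    (h : AcceptsBFA L n) :
    ∃ (σ : Type) (_ : Fintype σ), Fintype.card σ = 2 ^ n ∧
      ∃ D : DFA α σ, D.accepts = L.rev := by
  classical
  obtain ⟨σ, _, hn, A, rfl⟩ := h
  exact ⟨σ → Bool, inferInstance, by simp [hn], A.reverseDFA, A.accepts_reverseDFA⟩
end

section
/- If a language L over a finite alphabet Σ is accepted by an alternating finite automaton with n states (n ≥ 1), then the reversal L^R is accepted by a deterministic finite automaton with exactly 2^n states of which exactly 2^(n−1) are accepting states. -/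
/-- The action of a string on a Boolean function, as substitution of the state vector obtained
by processing the string from right to left. -/
theorem BFA.foldl_stepFn_apply {α σ : Type} (A : BFA α σ) (w : List α)
    (h : (σ → Bool) → Bool) (v : σ → Bool) :
    w.foldl A.stepFn h v = h (w.foldr (fun a u q => A.δ q a u) v) := by
  induction w generalizing h with
  | nil => rfl
  | cons a w ih => exact ih (A.stepFn h a)

/-- The DFA on state vectors that reads the reversals of the strings read by a BFA. -/
def BFA.revDFA {α σ : Type} (A : BFA α σ) : DFA α (σ → Bool) where
  step v a := fun q => A.δ q a v
  start := A.accept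
  accept := { v | A.g v = true }

theorem BFA.accepts_revDFA {α σ : Type} (A : BFA α σ) : A.revDFA.accepts = A.language.rev := by
  ext w
  change A.g (w.foldl (fun u a q => A.δ q a u) A.accept) = true ↔
    w.reverse.foldl A.stepFn A.g A.accept = true
  rw [A.foldl_stepFn_apply, List.foldr_reverse]

theorem Nat.card_setOf_apply_eq_true {σ : Type*} [Fintype σ] (q₀ : σ) :
    Nat.card { v : σ → Bool | v q₀ = true } = 2 ^ (Fintype.card σ - 1) := by
  classical
  have e : { v : σ → Bool // v q₀ = true } ≃ ({ q // q ≠ q₀ } → Bool) :=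
    { toFun := fun v q => v.1 q
      invFun := fun u => ⟨fun q => if hq : q = q₀ then true else u ⟨q, hq⟩, by simp⟩
      left_inv := by
        rintro ⟨v, hv⟩
        ext q
        by_cases hq : q = q₀ <;> simp [hq, hv]
      right_inv := by
        intro u
        ext ⟨q, hq⟩
        simp [hq] }
  calc
    Nat.card { v : σ → Bool | v q₀ = true } = Nat.card ({ q // q ≠ q₀ } → Bool) :=
      Nat.card_congr e
    _ = 2 ^ (Fintype.card σ - 1) := by simp

/-- If `L` is accepted by an `n`-state AFA (`n ≥ 1`), then `L^R` is accepted by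
a DFA with exactly `2^n` states of which exactly `2^(n-1)` are accepting. -/
theorem afa_to_dfa_reverse (α : Type) [Fintype α] (L : Language α) (n : ℕ) (hn : 1 ≤ n)
    (h : AcceptsAFA L n) :
    ∃ (σ : Type) (_ : Fintype σ), Fintype.card σ = 2 ^ n ∧
      ∃ D : DFA α σ, D.accepts = L.rev ∧ Nat.card D.accept = 2 ^ (n - 1) := by
  classical
  obtain ⟨σ, _, rfl, A, ⟨q₀, hg⟩, rfl⟩ := h
  refine ⟨σ → Bool, inferInstance, by simp, A.revDFA, A.accepts_revDFA, ?_⟩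
  simpa only [BFA.revDFA, hg] using Nat.card_setOf_apply_eq_true q₀
end

section
/- Let L be a language over a finite alphabet Σ accepted by a nondeterministic finite automaton with multiple initial states (MNFA) having exactly 2^n states whose reverse is deterministic, i.e., the MNFA has exactly one accepting state and for every state u and every symbol a there is exactly one state u' with u in the step set of u' on a. Then L is accepted by a Boolean finite automaton with n states. -/
open Classical in
/-- The BFA simulating an NFA `M` whose reverse is deterministic: the states of `M` are encoded as
Boolean vectors by `e`, `pred u a` is the predecessor of `u` on `a`, and `f` is the accepting
state. -/
noncomputable def NFA.toBFA {α σ τ : Type} (M : NFA α σ) (e : σ ≃ (τ → Bool)) (pred : σ → α → σ)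
    (f : σ) : BFA α τ where
  δ q a v := e (pred (e.symm v) a) q
  g v := decide (e.symm v ∈ M.start)
  accept := e f

theorem NFA.toBFA_eval {α σ τ : Type} (M : NFA α σ) (e : σ ≃ (τ → Bool)) (pred : σ → α → σ)
    (f : σ) (hpred : ∀ u a u', u ∈ M.step u' a ↔ u' = pred u a) (w : List α) (v : τ → Bool) :
    (M.toBFA e pred f).eval w v = true ↔ e.symm v ∈ M.eval w := by
  induction w using List.reverseRecOn generalizing v with
  | nil => simp [BFA.eval, NFA.toBFA]
  | append_singleton w a ih =>
    have h : (M.toBFA e pred f).eval (w ++ [a]) v =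
        (M.toBFA e pred f).eval w (e (pred (e.symm v) a)) := by
      simp [BFA.eval, BFA.stepFn, NFA.toBFA]
    rw [h, ih, Equiv.symm_apply_apply, NFA.eval_append_singleton, NFA.mem_stepSet]
    simp [hpred]

/-- If `L` is accepted by a `2^n`-state MNFA whose reverse is deterministic
(exactly one accepting state; for every state `u` and symbol `a` there is
exactly one `u'` with `u ∈ M.step u' a`), then `L` is accepted by an
`n`-state BFA. -/
theorem mnfa_reverse_deterministic_to_bfa (α : Type) [Fintype α] (L : Language α) (n : ℕ)
    (σ : Type) [Fintype σ] (M : NFA α σ)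
    (hcard : Fintype.card σ = 2 ^ n)
    (hacc : ∃! f : σ, f ∈ M.accept)
    (hdet : ∀ (u : σ) (a : α), ∃! u' : σ, u ∈ M.step u' a)
    (hL : M.accepts = L) :
    AcceptsBFA L n := by
  obtain ⟨f, hf, hf_unique⟩ := hacc
  choose pred hpred hpred_unique using hdet
  have e : σ ≃ (Fin n → Bool) := Fintype.equivOfCardEq (by simp [hcard])
  refine ⟨Fin n, inferInstance, Fintype.card_fin n, M.toBFA e pred f, ?_⟩
  rw [← hL]
  ext w
  change (M.toBFA e pred f).eval w (e f) = true ↔ ∃ s ∈ M.accept, s ∈ M.eval w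
  rw [M.toBFA_eval e pred f fun u a u' => ⟨hpred_unique u a u', fun h => h ▸ hpred u a⟩,
    Equiv.symm_apply_apply]
  exact ⟨fun h => ⟨f, hf, h⟩, fun ⟨s, hs, h⟩ => hf_unique s hs ▸ h⟩
end

section
/- If a language L over a finite alphabet Σ is accepted by a deterministic finite automaton with exactly 2^n states, then the reversal L^R is accepted by a Boolean finite automaton with n states. -/
open Classical in
/-- The BFA for the reversed language of a DFA whose states are encoded by Boolean vectors. -/
noncomputable def DFA.reverseBFA {α σ τ : Type} (D : DFA α σ) (e : σ ≃ (τ → Bool)) : BFA α τ where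
  δ q a v := e (D.step (e.symm v) a) q
  g v := decide (e.symm v ∈ D.accept)
  accept := e D.start

theorem DFA.eval_reverseBFA {α σ τ : Type} (D : DFA α σ) (e : σ ≃ (τ → Bool))
    (w : List α) (s : σ) :
    (D.reverseBFA e).eval w (e s) = true ↔ D.evalFrom s w.reverse ∈ D.accept := by
  induction w using List.reverseRecOn generalizing s with
  | nil => simp [BFA.eval, DFA.reverseBFA]
  | append_singleton w a ih =>
    have h : (D.reverseBFA e).eval (w ++ [a]) (e s) =
        (D.reverseBFA e).eval w (e (D.step s a)) := by
      simp [BFA.eval, BFA.stepFn, DFA.reverseBFA]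
    rw [h, ih]
    simp

theorem DFA.language_reverseBFA {α σ τ : Type} (D : DFA α σ) (e : σ ≃ (τ → Bool)) :
    (D.reverseBFA e).language = D.accepts.rev :=
  Set.ext fun w => D.eval_reverseBFA e w D.start

/-- If `L` is accepted by a DFA with exactly `2^n` states, then `L^R` is
accepted by an `n`-state BFA. -/
theorem dfa_to_bfa_reverse (α : Type) [Fintype α] (L : Language α) (n : ℕ)
    (σ : Type) [Fintype σ] (D : DFA α σ)
    (hcard : Fintype.card σ = 2 ^ n) (hL : D.accepts = L) :
    AcceptsBFA L.rev n := by
  subst hL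
  have e : σ ≃ (Fin n → Bool) := Fintype.equivOfCardEq (by simp [hcard])
  exact ⟨Fin n, inferInstance, Fintype.card_fin n, D.reverseBFA e, D.language_reverseBFA e⟩
end

section
/- If a language L over a finite alphabet Σ is accepted by a deterministic finite automaton with exactly 2^n states of which exactly 2^(n−1) are accepting (n ≥ 1), then the reversal L^R is accepted by an alternating finite automaton with n states. -/
/-- Half of the Boolean vectors of length `m + 1` have first coordinate `true`. -/
theorem natCard_boolVector_apply_zero (m : ℕ) :
    Nat.card {v : Fin (m + 1) → Bool // v 0 = true} = 2 ^ m := by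
  have e : {v : Fin (m + 1) → Bool // v 0 = true} ≃ (Fin m → Bool) :=
    { toFun := fun v => Fin.tail v.1
      invFun := fun u => ⟨Fin.cons true u, rfl⟩
      left_inv := fun v => Subtype.ext (by
        conv_rhs => rw [← Fin.cons_self_tail v.1, v.2])
      right_inv := fun u => Fin.tail_cons _ _ }
  rw [Nat.card_congr e]
  simp

/-- Two finite types of equal cardinality admit an equivalence matching given predicates
whose extents have equal cardinality. -/
theorem exists_equiv_iff_of_natCard_eq {σ τ : Type} [Finite σ] [Finite τ]
    (p : σ → Prop) (q : τ → Prop) (h : Nat.card σ = Nat.card τ)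
    (hpq : Nat.card {x // p x} = Nat.card {y // q y}) :
    ∃ e : σ ≃ τ, ∀ x, p x ↔ q (e x) := by
  classical
  have e₁ := (Finite.card_eq.1 h).some
  have e₂ := (Finite.card_eq.1 hpq).some
  have e₃ : {y // p (e₁.symm y)} ≃ {y // q y} :=
    (e₁.symm.subtypeEquiv fun _ => Iff.rfl).trans e₂
  refine ⟨e₁.trans e₃.extendSubtype, fun x => ⟨fun hx => ?_, fun hx => ?_⟩⟩
  · exact e₃.extendSubtype_mem (e₁ x) (by simpa using hx)
  · by_contra hn
    exact e₃.extendSubtype_not_mem (e₁ x) (by simpa using hn) hx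

/-- If `L` is accepted by a DFA with exactly `2^n` states of which exactly
`2^(n-1)` are accepting (`n ≥ 1`), then `L^R` is accepted by an `n`-state AFA. -/
theorem dfa_to_afa_reverse (α : Type) [Fintype α] (L : Language α) (n : ℕ) (hn : 1 ≤ n)
    (σ : Type) [Fintype σ] (D : DFA α σ)
    (hcard : Fintype.card σ = 2 ^ n)
    (hfin : Nat.card D.accept = 2 ^ (n - 1))
    (hL : D.accepts = L) :
    AcceptsAFA L.rev n := by
  obtain ⟨m, rfl⟩ := Nat.exists_eq_add_of_le' hn
  obtain ⟨e, he⟩ := exists_equiv_iff_of_natCard_eq (· ∈ D.accept)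
    (fun v : Fin (m + 1) → Bool => v 0 = true) (by simp [hcard])
    (hfin.trans (natCard_boolVector_apply_zero m).symm)
  refine ⟨Fin (m + 1), inferInstance, Fintype.card_fin _,
    ⟨fun q a v => e (D.step (e.symm v) a) q, fun v => v 0, e D.start⟩, ⟨0, rfl⟩, ?_⟩
  subst hL
  have key : ∀ w : List α,
      w.foldr (fun a u q => e (D.step (e.symm u) a) q) (e D.start) = e (D.eval w.reverse) := by
    intro w
    induction w with
    | nil => rfl
    | cons a w ih => simp [ih]
  ext w
  change BFA.eval _ w _ = true ↔ D.eval w.reverse ∈ D.accept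
  rw [he, BFA.eval, BFA.foldl_stepFn_apply, key]
end

section
/- Every language over a finite alphabet Σ accepted by a Boolean finite automaton with n states is accepted by a deterministic finite automaton with at most 2^(2^n) states. Moreover, for every n ≥ 1 there exists a language over a two-letter alphabet accepted by an n-state Boolean finite automaton such that every deterministic finite automaton accepting it has at least 2^(2^n) states. -/
namespace BFA

variable {α σ : Type}

/-- The DFA whose states are the Boolean functions over the states of a BFA. -/
def toDFA (A : BFA α σ) : DFA α ((σ → Bool) → Bool) where
  step := A.stepFn
  start := A.g
  accept := { h | h A.accept = true }

theorem accepts_toDFA (A : BFA α σ) : A.toDFA.accepts = A.language := rfl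

theorem eval_append (A : BFA α σ) (w u : List α) :
    A.eval (w ++ u) = u.foldl A.stepFn (A.eval w) :=
  List.foldl_append

theorem card_boolFn (σ : Type) [Fintype σ] [DecidableEq σ] :
    Fintype.card ((σ → Bool) → Bool) = 2 ^ 2 ^ Fintype.card σ := by
  simp

/-- If every Boolean function is reachable in a BFA and every vector can be brought to the
finality vector, then the reachable functions are pairwise inequivalent, so that every DFA for
the language has at least as many states as there are Boolean functions. -/
theorem two_pow_two_pow_card_le [Fintype σ] (A : BFA α σ)
    (hfn : ∀ h, ∃ w, A.eval w = h)
    (hvec : ∀ v, ∃ u : List α, ∀ h, u.foldl A.stepFn h A.accept = h v)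
    {τ : Type} [Fintype τ] (D : DFA α τ) (hD : D.accepts = A.language) :
    2 ^ 2 ^ Fintype.card σ ≤ Fintype.card τ := by
  classical
  choose w hw using hfn
  rw [← card_boolFn σ]
  refine Fintype.card_le_of_injective (fun h => D.eval (w h)) fun h h' hhh => ?_
  funext v
  obtain ⟨u, hu⟩ := hvec v
  have key : ∀ k, D.evalFrom (D.eval (w k)) u ∈ D.accept ↔ k v = true := fun k => by
    have hmem : w k ++ u ∈ D.accepts ↔ w k ++ u ∈ A.language := by rw [hD]
    rw [DFA.mem_accepts, DFA.eval, DFA.evalFrom_of_append] at hmem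
    refine hmem.trans ?_
    change A.eval (w k ++ u) A.accept = true ↔ _
    rw [eval_append, hu, hw]
  rw [Bool.eq_iff_iff, ← key h, ← key h']
  exact iff_of_eq (congrArg (fun s => D.evalFrom s u ∈ D.accept) hhh)

end BFA

section CyclicWords

variable {N : ℕ}

/-- The map on `ZMod N` that sends `0` to `1` and fixes every other element. -/
def mergeZero (x : ZMod N) : ZMod N := if x = 0 then 1 else x

/-- A set of cyclic Boolean words closed under rotation by one place is closed under every
rotation. -/
theorem rotate_mem [NeZero N] {R : Set (ZMod N → Bool)}
    (hrot : ∀ h ∈ R, (fun x => h (x + 1)) ∈ R) (m : ZMod N) {h : ZMod N → Bool} (hh : h ∈ R) :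
    (fun x => h (x + m)) ∈ R := by
  have aux : ∀ k : ℕ, (fun x => h (x + (k : ZMod N))) ∈ R := by
    intro k
    induction k with
    | zero => simpa using hh
    | succ k ih =>
      have := hrot _ ih
      simpa [add_assoc, add_comm (1 : ZMod N)] using this
  simpa using aux m.val

/-- Closure under rotation and under copying place `1` to place `0` gives closure under copying
any place to its predecessor. -/
theorem copy_mem [NeZero N] {R : Set (ZMod N → Bool)}
    (hrot : ∀ h ∈ R, (fun x => h (x + 1)) ∈ R) (hmerge : ∀ h ∈ R, (fun x => h (mergeZero x)) ∈ R)
    (i : ZMod N) {h : ZMod N → Bool} (hh : h ∈ R) :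
    Function.update h i (h (i + 1)) ∈ R := by
  have := rotate_mem hrot (-i) (hmerge _ (rotate_mem hrot i hh))
  convert this using 1
  funext x
  by_cases hx : x = i
  · simp [hx, mergeZero, add_comm]
  · have : x + -i ≠ 0 := by rwa [← sub_eq_add_neg, sub_ne_zero]
    simp [hx, mergeZero, this]

/-- From an alternating cyclic word, every cyclic word is reachable by rotations and by copying
place `1` to place `0`. -/
theorem mem_of_alternating_mem [NeZero N] {R : Set (ZMod N → Bool)}
    (hrot : ∀ h ∈ R, (fun x => h (x + 1)) ∈ R) (hmerge : ∀ h ∈ R, (fun x => h (mergeZero x)) ∈ R)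
    {g : ZMod N → Bool} (hg : g ∈ R) (halt : ∀ x, g (x + 1) = !g x) (h : ZMod N → Bool) :
    h ∈ R := by
  have aux : ∀ k : ℕ, ∀ h : ZMod N → Bool,
      (∀ j : ℕ, k ≤ j → j + 1 < N → h ((j : ZMod N) + 1) = !h j) → h ∈ R := by
    intro k
    induction k with
    | zero =>
      intro h hh
      have huniq : ∀ f : ZMod N → Bool, (∀ x, f (x + 1) = !f x) → f 0 = h 0 → f = h := by
        intro f hf h0
        have : ∀ j : ℕ, j < N → f j = h j := by
          intro j
          induction j with
          | zero => intro _; simpa using h0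
          | succ j ih =>
            intro hj
            push_cast
            rw [hf, hh j (Nat.zero_le _) hj, ih (by omega)]
        funext x
        simpa using this x.val x.val_lt
      by_cases h0 : g 0 = h 0
      · exact huniq g halt h0 ▸ hg
      · refine huniq (fun x => g (x + 1)) (fun x => halt (x + 1)) ?_ ▸ hrot g hg
        rw [halt]
        cases hg0 : g 0 <;> cases hh0 : h 0 <;> simp_all
    | succ k ih =>
      intro h hh
      by_cases hk : k + 1 < N
      swap
      · exact ih h fun j hj hjN => absurd hjN (by omega)
      by_cases hkk : h ((k : ZMod N) + 1) = !h k
      · refine ih h fun j hj hjN => ?_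
        rcases hj.eq_or_lt with rfl | hj
        · exact hkk
        · exact hh j hj hjN
      have hne : ∀ j : ℕ, k < j → j < N → (j : ZMod N) ≠ k := by
        intro j hj hjN hjk
        have := congrArg ZMod.val hjk
        rw [ZMod.val_cast_of_lt hjN, ZMod.val_cast_of_lt (by omega)] at this
        omega
      have hne' : ∀ j : ℕ, k ≤ j → j + 1 < N → (j : ZMod N) + 1 ≠ k := fun j hj hjN => by
        simpa using hne (j + 1) (by omega) hjN
      have hmem : Function.update h (k : ZMod N) (!h k) ∈ R := by
        refine ih _ fun j hj hjN => ?_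
        rw [Function.update_of_ne (hne' j hj hjN)]
        rcases hj.eq_or_lt with rfl | hj
        · simpa using hkk
        · rw [Function.update_of_ne (hne j hj (by omega)), hh j hj hjN]
      have := copy_mem hrot hmerge (k : ZMod N) hmem
      rw [Function.update_of_ne (hne' k le_rfl hk), Function.update_idem] at this
      convert this using 1
      rw [eq_comm, Function.update_eq_self_iff]
      simpa using hkk
  exact aux N h fun j hj hjN => absurd hjN (by omega)

/-- Cyclic words of even length can alternate. -/
theorem exists_alternating (hN : 2 ∣ N) : ∃ g : ZMod N → Bool, ∀ x, g (x + 1) = !g x := by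
  refine ⟨fun x => decide (ZMod.castHom hN (ZMod 2) x = 0), fun x => ?_⟩
  dsimp only
  rw [map_add, map_one]
  generalize ZMod.castHom hN (ZMod 2) x = y
  revert y
  decide

end CyclicWords

/-- The BFA which, after identifying state vectors with `ZMod N`, acts on them by rotation
(symbol `0`) and by `mergeZero` (symbol `1`). -/
def BFA.cyclic {σ : Type} {N : ℕ} (e : (σ → Bool) ≃ ZMod N) (g : ZMod N → Bool) :
    BFA (Fin 2) σ where
  δ q a v := e.symm (if a = 0 then e v + 1 else mergeZero (e v)) q
  g v := g (e v)
  accept := e.symm 0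

theorem BFA.stepFn_cyclic {σ : Type} {N : ℕ} (e : (σ → Bool) ≃ ZMod N) (g : ZMod N → Bool)
    (h : (σ → Bool) → Bool) (a : Fin 2) (v : σ → Bool) :
    (cyclic e g).stepFn h a v = h (e.symm (if a = 0 then e v + 1 else mergeZero (e v))) := rfl

theorem BFA.foldl_stepFn_cyclic_replicate {σ : Type} {N : ℕ} (e : (σ → Bool) ≃ ZMod N)
    (g : ZMod N → Bool) (k : ℕ) (h : (σ → Bool) → Bool) (v : σ → Bool) :
    (List.replicate k (0 : Fin 2)).foldl (cyclic e g).stepFn h v = h (e.symm (e v + k)) := by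
  induction k generalizing h with
  | zero => simp
  | succ k ih =>
    rw [List.replicate_succ, List.foldl_cons, ih, stepFn_cyclic]
    simp [add_assoc]

theorem BFA.exists_eval_cyclic_eq {σ : Type} {N : ℕ} [NeZero N] (e : (σ → Bool) ≃ ZMod N)
    {g : ZMod N → Bool} (halt : ∀ x, g (x + 1) = !g x) (h : (σ → Bool) → Bool) :
    ∃ w, (cyclic e g).eval w = h := by
  have hstep : ∀ (f : ZMod N → Bool) (a : Fin 2), (∃ w, (cyclic e g).eval w = fun v => f (e v)) →
      ∃ w, (cyclic e g).eval w =
        fun v => f (if a = 0 then e v + 1 else mergeZero (e v)) := by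
    rintro f a ⟨w, hw⟩
    refine ⟨w ++ [a], ?_⟩
    funext v
    rw [eval_append, hw, List.foldl_cons, List.foldl_nil, stepFn_cyclic, e.apply_symm_apply]
  have hmem := mem_of_alternating_mem (R := {f | ∃ w, (cyclic e g).eval w = fun v => f (e v)})
    (fun f hf => hstep f 0 hf) (fun f hf => hstep f 1 hf) (g := g) ⟨[], rfl⟩ halt
    (fun x => h (e.symm x))
  simpa using hmem

/-- Every language accepted by an `n`-state BFA is accepted by a DFA with at
most `2^(2^n)` states; moreover for every `n ≥ 1` there is a binary language
accepted by an `n`-state BFA every DFA for which has at least `2^(2^n)` states. -/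
theorem bfa_to_dfa_tight :
    (∀ (α : Type) [Fintype α] (L : Language α) (n : ℕ), AcceptsBFA L n →
      ∃ m ≤ 2 ^ 2 ^ n, AcceptsDFA L m) ∧
    ∀ n : ℕ, 1 ≤ n → ∃ L : Language (Fin 2), AcceptsBFA L n ∧
      ∀ m : ℕ, AcceptsDFA L m → 2 ^ 2 ^ n ≤ m := by
  classical
  constructor
  · rintro α _ L n ⟨σ, _, rfl, A, rfl⟩
    exact ⟨_, le_rfl, _, inferInstance, BFA.card_boolFn σ, A.toDFA, A.accepts_toDFA⟩
  · intro n hn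
    obtain ⟨g, halt⟩ := exists_alternating (dvd_pow_self 2 (by omega : n ≠ 0))
    have e : (Fin n → Bool) ≃ ZMod (2 ^ n) := Fintype.equivOfCardEq (by simp)
    refine ⟨(BFA.cyclic e g).language, ⟨Fin n, inferInstance, Fintype.card_fin n, _, rfl⟩, ?_⟩
    rintro m ⟨τ, _, rfl, D, hD⟩
    have hvec : ∀ v, ∃ u : List (Fin 2), ∀ h,
        u.foldl (BFA.cyclic e g).stepFn h (BFA.cyclic e g).accept = h v := fun v => by
      refine ⟨List.replicate (e v).val 0, fun h => ?_⟩
      rw [BFA.foldl_stepFn_cyclic_replicate]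
      simp [BFA.cyclic]
    simpa using BFA.two_pow_two_pow_card_le _ (BFA.exists_eval_cyclic_eq e halt) hvec D hD
end

section
/- Let K and L be languages over a finite alphabet Σ accepted by an m-state Boolean finite automaton and an n-state Boolean finite automaton, respectively. Then the concatenation KL is accepted by a Boolean finite automaton with at most 2^m + n states. -/
namespace BFA

variable {α σ τ : Type}

/-- The vector of truth values of the states after reading `w` from right to left,
starting from the finality vector. -/
def vec (A : BFA α σ) (w : List α) : σ → Bool :=
  w.foldr (fun a v q => A.δ q a v) A.accept

theorem foldl_stepFn (A : BFA α σ) (w : List α) (h : (σ → Bool) → Bool) (v : σ → Bool) :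
    w.foldl A.stepFn h v = h (w.foldr (fun a v q => A.δ q a v) v) := by
  induction w generalizing h with
  | nil => rfl
  | cons a w ih => simp [ih, stepFn]

theorem mem_language_iff (A : BFA α σ) (w : List α) :
    w ∈ A.language ↔ A.g (A.vec w) = true :=
  iff_of_eq (congrArg (· = true) (A.foldl_stepFn w A.g A.accept))

open Classical in
/-- A BFA for the concatenation. The state `inl p` accepts the words `x ++ y` with `A.vec x = p`
and `y` accepted by `B`; the states `inr q` simulate `B`. -/
noncomputable def concat (A : BFA α σ) (B : BFA α τ) : BFA α ((σ → Bool) ⊕ τ) where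
  δ s a v := s.elim
    (fun p => decide ((∃ u, (fun q => A.δ q a u) = p ∧ v (Sum.inl u) = true) ∨
      (A.accept = p ∧ B.g (fun q => B.δ q a fun r => v (Sum.inr r)) = true)))
    (fun q => B.δ q a fun r => v (Sum.inr r))
  g v := decide (∃ p, A.g p = true ∧ v (Sum.inl p) = true)
  accept s := s.elim (fun p => decide (A.accept = p ∧ B.g B.accept = true)) B.accept

theorem concat_vec_inr (A : BFA α σ) (B : BFA α τ) (w : List α) (q : τ) :
    (A.concat B).vec w (Sum.inr q) = B.vec w q := by
  induction w generalizing q with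
  | nil => rfl
  | cons a w ih =>
    change B.δ q a (fun r => (A.concat B).vec w (Sum.inr r)) = B.δ q a (B.vec w)
    simp only [ih]

theorem concat_vec_inl (A : BFA α σ) (B : BFA α τ) (w : List α) (p : σ → Bool) :
    (A.concat B).vec w (Sum.inl p) = true ↔
      ∃ x y, x ++ y = w ∧ A.vec x = p ∧ B.g (B.vec y) = true := by
  induction w generalizing p with
  | nil => simp [vec, concat]
  | cons a w ih =>
    have step : (A.concat B).vec (a :: w) (Sum.inl p) = true ↔
        (∃ u, (fun q => A.δ q a u) = p ∧ (A.concat B).vec w (Sum.inl u) = true) ∨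
          (A.accept = p ∧
            B.g (fun q => B.δ q a fun r => (A.concat B).vec w (Sum.inr r)) = true) := by
      classical exact decide_eq_true_iff
    rw [step]
    simp only [ih, concat_vec_inr]
    constructor
    · rintro (⟨_, hp, x, y, rfl, rfl, hy⟩ | ⟨hp, hg⟩)
      · exact ⟨a :: x, y, rfl, hp, hy⟩
      · exact ⟨[], a :: w, rfl, hp, hg⟩
    · rintro ⟨x, y, hxy, hp, hy⟩
      cases x with
      | nil =>
        obtain rfl : y = a :: w := hxy
        exact Or.inr ⟨hp, hy⟩
      | cons b x =>
        obtain ⟨rfl, rfl⟩ := List.cons.inj hxy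
        exact Or.inl ⟨A.vec x, hp, x, y, rfl, rfl, hy⟩

theorem concat_language (A : BFA α σ) (B : BFA α τ) :
    (A.concat B).language = A.language * B.language := by
  ext w
  have hg : (A.concat B).g ((A.concat B).vec w) = true ↔
      ∃ p, A.g p = true ∧ (A.concat B).vec w (Sum.inl p) = true := by
    classical exact decide_eq_true_iff
  simp only [mem_language_iff, hg, concat_vec_inl, Language.mem_mul]
  constructor
  · rintro ⟨_, hp, x, y, hw, rfl, hy⟩
    exact ⟨x, hp, y, hy, hw⟩
  · rintro ⟨x, hx, y, hy, hw⟩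
    exact ⟨_, hx, x, y, hw, rfl, hy⟩

end BFA

/-- Concatenation on BFAs, upper bound: if `K` and `L` are accepted by an
`m`-state and an `n`-state BFA, then `K * L` is accepted by a BFA with at most
`2^m + n` states. -/
theorem bfa_concat_upper (α : Type) [Fintype α] (K L : Language α) (m n : ℕ)
    (hK : AcceptsBFA K m) (hL : AcceptsBFA L n) :
    ∃ k ≤ 2 ^ m + n, AcceptsBFA (K * L) k := by
  classical
  obtain ⟨σ, _, rfl, A, rfl⟩ := hK
  obtain ⟨τ, _, rfl, B, rfl⟩ := hL
  exact ⟨_, le_rfl, (σ → Bool) ⊕ τ, inferInstance, by simp, A.concat B, A.concat_language B⟩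
end

section
/- For every n ≥ 2 there exists a language L over a two-letter alphabet accepted by an n-state alternating finite automaton such that every Boolean finite automaton accepting the Kleene star L* has at least 2^n states. -/
/-- The deterministic automaton on the state vectors of a Boolean automaton. It reads its input
in the reverse order. -/
def BFA.toDFA_s12 {α σ : Type} (A : BFA α σ) : DFA α (σ → Bool) where
  step v a q := A.δ q a v
  start := A.accept
  accept := { v | A.g v = true }

theorem BFA.foldl_stepFn_s12 {α σ : Type} (A : BFA α σ) (w : List α) (h : (σ → Bool) → Bool)
    (v : σ → Bool) : w.foldl A.stepFn h v = h (A.toDFA_s12.evalFrom v w.reverse) := by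
  induction w generalizing h with
  | nil => rfl
  | cons a w ih =>
    rw [List.foldl_cons, ih, List.reverse_cons, DFA.evalFrom_append_singleton]
    rfl

theorem BFA.language_eq_reverse {α σ : Type} (A : BFA α σ) :
    A.language = A.toDFA_s12.accepts.reverse := by
  ext w
  change A.eval w A.accept = true ↔ w.reverse ∈ A.toDFA_s12.accepts
  rw [BFA.eval, A.foldl_stepFn_s12]
  rfl

/-- If the accepting state vectors of a DFA are exactly those with a given coordinate set, then
the reversed language is accepted by an alternating automaton. -/
theorem DFA.exists_afa_reverse {α σ : Type} (M : DFA α (σ → Bool)) (q₀ : σ)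
    (hM : M.accept = { v | v q₀ = true }) :
    ∃ A : BFA α σ, A.IsAFA ∧ A.language = M.accepts.reverse := by
  refine ⟨⟨fun q a v => M.step v a q, fun v => v q₀, M.start⟩, ⟨q₀, rfl⟩, ?_⟩
  rw [BFA.language_eq_reverse]
  congr 2
  cases M
  cases hM
  rfl

namespace DFA

variable {α Q : Type}

/-- One step of the subset automaton for the Kleene star: whenever a final state is entered, the
start state is added. -/
def starStep (D : DFA α Q) (S : Set Q) (a : α) : Set Q :=
  { q | (∃ p ∈ S, D.step p a = q) ∨ (q = D.start ∧ ∃ p ∈ S, D.step p a ∈ D.accept) }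

/-- The set of states reached by the subset automaton for the Kleene star. -/
def starEval (D : DFA α Q) (u : List α) : Set Q :=
  u.foldl D.starStep {D.start}

theorem mem_kstar_iff_of_ne_nil (D : DFA α Q) {u : List α} (hu : u ≠ []) :
    u ∈ KStar.kstar D.accepts ↔
      ∃ x ∈ KStar.kstar D.accepts, ∃ y, D.eval y ∈ D.accept ∧ x ++ y = u := by
  conv_lhs => rw [← Language.one_add_kstar_mul_self_eq_kstar]
  rw [Language.mem_add, Language.mem_one, Language.mem_mul]
  constructor
  · rintro (h | h)
    · exact absurd h hu
    · exact h
  · exact Or.inr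

theorem mem_starEval (D : DFA α Q) (hD : D.start ∉ D.accept) (u : List α) (q : Q) :
    q ∈ D.starEval u ↔ ∃ x ∈ KStar.kstar D.accepts, ∃ y, D.eval y = q ∧ x ++ y = u := by
  induction u using List.reverseRecOn generalizing q with
  | nil =>
    simp only [starEval, List.foldl_nil, Set.mem_singleton_iff, List.append_eq_nil_iff]
    constructor
    · rintro rfl
      exact ⟨[], Language.nil_mem_kstar _, [], rfl, rfl, rfl⟩
    · rintro ⟨x, -, y, rfl, -, rfl⟩
      rfl
  | append_singleton u a ih =>
    have hstep : D.starEval (u ++ [a]) = D.starStep (D.starEval u) a := by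
      simp [starEval]
    have hacc : (∃ p ∈ D.starEval u, D.step p a ∈ D.accept) ↔
        u ++ [a] ∈ KStar.kstar D.accepts := by
      rw [D.mem_kstar_iff_of_ne_nil (by simp)]
      constructor
      · rintro ⟨p, hp, hpa⟩
        obtain ⟨x, hx, y, rfl, rfl⟩ := (ih p).1 hp
        exact ⟨x, hx, y ++ [a], by rwa [eval_append_singleton], by simp⟩
      · rintro ⟨x, hx, y, hy, hxy⟩
        rcases List.eq_nil_or_concat' y with rfl | ⟨z, b, rfl⟩
        · exact absurd hy hD
        · rw [← List.append_assoc] at hxy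
          obtain ⟨h₁, h₂⟩ := List.append_inj' hxy rfl
          obtain rfl : b = a := by simpa using h₂
          exact ⟨D.eval z, (ih _).2 ⟨x, hx, z, rfl, h₁⟩, by rwa [← eval_append_singleton]⟩
    rw [hstep]
    simp only [starStep, Set.mem_ofPred_eq, hacc]
    constructor
    · rintro (⟨p, hp, rfl⟩ | ⟨rfl, h⟩)
      · obtain ⟨x, hx, y, rfl, rfl⟩ := (ih p).1 hp
        exact ⟨x, hx, y ++ [a], eval_append_singleton .., by simp⟩
      · exact ⟨_, h, [], rfl, by simp⟩
    · rintro ⟨x, hx, y, rfl, hxy⟩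
      rcases List.eq_nil_or_concat' y with rfl | ⟨z, b, rfl⟩
      · rw [List.append_nil] at hxy
        exact Or.inr ⟨rfl, hxy ▸ hx⟩
      · rw [← List.append_assoc] at hxy
        obtain ⟨h₁, h₂⟩ := List.append_inj' hxy rfl
        obtain rfl : b = a := by simpa using h₂
        exact Or.inl ⟨D.eval z, (ih _).2 ⟨x, hx, z, rfl, h₁⟩, (eval_append_singleton ..).symm⟩

theorem mem_kstar_iff_starEval (D : DFA α Q) (hD : D.start ∉ D.accept) {u : List α}
    (hu : u ≠ []) :
    u ∈ KStar.kstar D.accepts ↔ ∃ q ∈ D.starEval u, q ∈ D.accept := by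
  rw [D.mem_kstar_iff_of_ne_nil hu]
  simp only [D.mem_starEval hD]
  constructor
  · rintro ⟨x, hx, y, hy, h⟩
    exact ⟨_, ⟨x, hx, y, rfl, h⟩, hy⟩
  · rintro ⟨_, ⟨x, hx, y, rfl, h⟩, hy⟩
    exact ⟨x, hx, y, hy, h⟩

/-- A nonempty word leads the subset automaton for the Kleene star to acceptance from exactly the
sets that meet `P`. -/
def StarTests (D : DFA α Q) (P : Set Q) : Prop :=
  ∃ w : List α, w ≠ [] ∧
    ∀ S : Set Q, (∃ q ∈ w.foldl D.starStep S, q ∈ D.accept) ↔ ∃ q ∈ S, q ∈ P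

theorem exists_mem_starStep (D : DFA α Q) {P : Set Q} (hP : D.start ∈ P → P = D.accept)
    (S : Set Q) (a : α) :
    (∃ q ∈ D.starStep S a, q ∈ P) ↔ ∃ q ∈ S, D.step q a ∈ P := by
  constructor
  · rintro ⟨q, ⟨p, hp, rfl⟩ | ⟨rfl, p, hp, h⟩, hq⟩
    · exact ⟨p, hp, hq⟩
    · exact ⟨p, hp, by rwa [hP hq]⟩
  · rintro ⟨p, hp, h⟩
    exact ⟨_, Or.inl ⟨p, hp, rfl⟩, h⟩

theorem starTests_preimage_accept (D : DFA α Q) (a : α) :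
    D.StarTests ((D.step · a) ⁻¹' D.accept) :=
  ⟨[a], by simp, fun S => D.exists_mem_starStep (fun _ => rfl) S a⟩

theorem StarTests.preimage {D : DFA α Q} {P : Set Q} (h : D.StarTests P) (hP : D.start ∉ P)
    (a : α) : D.StarTests ((D.step · a) ⁻¹' P) := by
  obtain ⟨w, -, hw⟩ := h
  refine ⟨a :: w, by simp, fun S => ?_⟩
  rw [List.foldl_cons, hw]
  exact D.exists_mem_starStep (fun h => absurd h hP) S a

/-- A DFA for the Kleene star is large when all sets containing the start state are reachable
in the subset automaton and all states other than the start state can be tested. -/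
theorem lt_card_of_accepts_kstar [Fintype Q] [DecidableEq Q] (D : DFA α Q)
    (hD : D.start ∉ D.accept)
    (hreach : ∀ S : Finset Q, D.start ∈ S → ∃ u, u ≠ [] ∧ D.starEval u = S)
    (htest : ∀ q, q ≠ D.start → D.StarTests {q})
    {R : Type} [Fintype R] (M : DFA α R) (hM : M.accepts = KStar.kstar D.accepts) :
    2 ^ (Fintype.card Q - 1) < Fintype.card R := by
  have key : ∀ T : Finset {q // q ≠ D.start}, ∃ u, u ≠ [] ∧
      D.starEval u = insert D.start (Subtype.val '' (T : Set {q // q ≠ D.start})) := by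
    intro T
    obtain ⟨u, hu, h⟩ := hreach (insert D.start (T.map (Function.Embedding.subtype _))) (by simp)
    refine ⟨u, hu, h.trans ?_⟩
    simp
  choose u hu hS using key
  have hmem : ∀ T (q : {q // q ≠ D.start}), q.1 ∈ D.starEval (u T) ↔ q ∈ T := by
    intro T q
    rw [hS, Set.mem_insert_iff, or_iff_right q.2]
    simp [q.2]
  have hsuffix : ∀ {x y : List α}, M.eval x = M.eval y → ∀ w,
      (x ++ w ∈ KStar.kstar D.accepts ↔ y ++ w ∈ KStar.kstar D.accepts) := by
    intro x y hxy w
    have h : M.eval (x ++ w) = M.eval (y ++ w) := by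
      simp only [eval, evalFrom_of_append] at hxy ⊢
      rw [hxy]
    rw [← hM, mem_accepts, mem_accepts, h]
  have htail : ∀ {x y : List α}, M.eval x = M.eval y → ∀ q, q ≠ D.start →
      (q ∈ D.starEval x ↔ q ∈ D.starEval y) := by
    intro x y hxy q hq
    obtain ⟨w, hw, h⟩ := htest q hq
    have := hsuffix hxy w
    rw [D.mem_kstar_iff_starEval hD (by simp [hw]), D.mem_kstar_iff_starEval hD (by simp [hw])]
      at this
    simpa [starEval, h] using this
  have hnil : ∀ T, M.eval [] ≠ M.eval (u T) := by
    intro T h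
    have hacc := (hsuffix h []).1 (Language.nil_mem_kstar _)
    rw [List.append_nil, D.mem_kstar_iff_starEval hD (hu T)] at hacc
    obtain ⟨q, hq, hqF⟩ := hacc
    have hne : q ≠ D.start := fun h => hD (h ▸ hqF)
    exact hne ((htail h q hne).2 hq)
  have hinj : Function.Injective
      (fun i : Option (Finset {q // q ≠ D.start}) => i.elim (M.eval []) fun T => M.eval (u T)) := by
    rintro (_ | T) (_ | T') h
    · rfl
    · exact absurd h (hnil T')
    · exact absurd h.symm (hnil T)
    · congr 1
      ext q
      rw [← hmem, ← hmem]
      exact htail h q.1 q.2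
  have hcard := Fintype.card_le_of_injective _ hinj
  rw [Fintype.card_option, Fintype.card_finset, Fintype.card_subtype_compl,
    Fintype.card_subtype_eq] at hcard
  exact hcard

end DFA

/-- A binary automaton on `m` states whose final states are the odd ones. The symbol `0` fixes the
state `0` and moves `i` to `i + 1`, with `m - 1` sent to `0`; the symbol `1` sends `0` and `1`
to `1` and rotates the remaining states. -/
def starWitness (m : ℕ) (hm : 4 ≤ m) : DFA (Fin 2) (Fin m) where
  step q c :=
    if c = 0 then
      ⟨if q.1 = 0 ∨ q.1 = m - 1 then 0 else q.1 + 1, by split_ifs <;> omega⟩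
    else
      ⟨if q.1 ≤ 1 then 1 else if q.1 = m - 1 then 2 else q.1 + 1, by split_ifs <;> omega⟩
  start := ⟨0, by omega⟩
  accept := { q | q.1 % 2 = 1 }

namespace starWitness

variable {m : ℕ} (hm : 4 ≤ m)

theorem start_notMem_accept : (starWitness m hm).start ∉ (starWitness m hm).accept := by
  simp [starWitness]

theorem step_zero_val (q : Fin m) :
    ((starWitness m hm).step q 0).1 = if q.1 = 0 ∨ q.1 = m - 1 then 0 else q.1 + 1 := rfl

theorem step_one_val (q : Fin m) :
    ((starWitness m hm).step q 1).1 =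
      if q.1 ≤ 1 then 1 else if q.1 = m - 1 then 2 else q.1 + 1 := rfl

theorem start_val : (starWitness m hm).start.1 = 0 := rfl

theorem mem_accept (q : Fin m) : q ∈ (starWitness m hm).accept ↔ q.1 % 2 = 1 := Iff.rfl

theorem starTests_shift (j : ℕ) :
    (starWitness m hm).StarTests
      { q : Fin m | q.1 ≠ 0 ∧ q.1 + (j + 1) < m ∧ (q.1 + (j + 1)) % 2 = 1 } := by
  induction j with
  | zero =>
    convert (starWitness m hm).starTests_preimage_accept 0 using 1
    ext q
    have := q.2
    simp only [Set.mem_ofPred_eq, Set.mem_preimage, mem_accept, step_zero_val]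
    grind
  | succ j ih =>
    convert ih.preimage (by simp [start_val]) 0 using 1
    ext q
    have := q.2
    simp only [Set.mem_ofPred_eq, Set.mem_preimage, step_zero_val]
    split_ifs <;> omega

theorem starTests_singleton (hme : m % 2 = 0) (q : Fin m) (hq : q ≠ (starWitness m hm).start) :
    (starWitness m hm).StarTests {q} := by
  have hq0 : q.1 ≠ 0 := fun h => hq (Fin.ext h)
  have two : (starWitness m hm).StarTests { q : Fin m | q.1 = 2 } := by
    convert starTests_shift hm (m - 4) using 1
    ext q
    have := q.2
    simp only [Set.mem_ofPred_eq]
    omega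
  have rotate : ∀ j, j + 3 ≤ m → (starWitness m hm).StarTests { q : Fin m | q.1 + j + 1 = m } := by
    intro j
    induction j with
    | zero =>
      intro _
      convert two.preimage (by simp [start_val]) 1 using 1
      ext q
      have := q.2
      simp only [Set.mem_ofPred_eq, Set.mem_preimage, step_one_val]
      split_ifs <;> omega
    | succ j ih =>
      intro hj
      convert (ih (by omega)).preimage (by simp [start_val]; omega) 1 using 1
      ext q
      have := q.2
      simp only [Set.mem_ofPred_eq, Set.mem_preimage, step_one_val]
      split_ifs <;> omega
  rcases Nat.lt_or_ge q.1 2 with h | h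
  · convert two.preimage (by simp [start_val]) 0 using 1
    ext p
    have := p.2
    simp only [Set.mem_singleton_iff, Fin.ext_iff, Set.mem_ofPred_eq, Set.mem_preimage,
      step_zero_val]
    grind
  · have := q.2
    convert rotate (m - 1 - q.1) (by omega) using 1
    ext p
    simp only [Set.mem_singleton_iff, Fin.ext_iff, Set.mem_ofPred_eq]
    omega

theorem exists_starEval_eq_of_preimage {S S' : Finset (Fin m)} (c : Fin 2)
    (h0 : (starWitness m hm).start ∈ (starWitness m hm).starStep S' c)
    (hS : (starWitness m hm).start ∈ S)
    (hmaps : ∀ p ∈ S', (starWitness m hm).step p c ∈ S)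
    (hsurj : ∀ q ∈ S, q ≠ (starWitness m hm).start → ∃ p ∈ S', (starWitness m hm).step p c = q)
    (hS' : ∃ u, u ≠ [] ∧ (starWitness m hm).starEval u = S') :
    ∃ u, u ≠ [] ∧ (starWitness m hm).starEval u = S := by
  obtain ⟨u, -, hu⟩ := hS'
  refine ⟨u ++ [c], by simp, ?_⟩
  have : (starWitness m hm).starEval (u ++ [c]) =
      (starWitness m hm).starStep ((starWitness m hm).starEval u) c := by
    simp [DFA.starEval]
  rw [this, hu]
  ext q
  constructor
  · rintro (⟨p, hp, rfl⟩ | ⟨rfl, -⟩)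
    · exact hmaps p hp
    · exact hS
  · intro hq
    by_cases h : q = (starWitness m hm).start
    · exact h ▸ h0
    · exact Or.inl (hsurj q hq h)

theorem exists_starEval_eq (S : Finset (Fin m)) (hS : (starWitness m hm).start ∈ S) :
    ∃ u, u ≠ [] ∧ (starWitness m hm).starEval u = S := by
  have hzero := step_zero_val hm
  have hone := step_one_val hm
  have hacc := mem_accept hm
  have hstart := start_val hm
  have hlift := fun S S' c => exists_starEval_eq_of_preimage hm (S := S) (S' := S') c
  have hstep : ∀ S p c, p ∈ S → (starWitness m hm).step p c ∈ (starWitness m hm).accept →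
      (starWitness m hm).start ∈ (starWitness m hm).starStep S c :=
    fun S p c hp h => Or.inr ⟨rfl, p, hp, h⟩
  have hstep' : ∀ S p c, p ∈ S → (starWitness m hm).step p c = (starWitness m hm).start →
      (starWitness m hm).start ∈ (starWitness m hm).starStep S c :=
    fun S p c hp h => Or.inl ⟨p, hp, h⟩
  generalize starWitness m hm = D at *
  have hval : ∀ q : Fin m, q ≠ D.start → q.1 ≠ 0 := fun q h h' => h (Fin.ext (h'.trans hstart.symm))
  induction hk : S.card using Nat.strong_induction_on generalizing S with
  | _ k ihk =>
  by_cases hne : ∃ q ∈ S, q ≠ D.start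
  swap
  · have hS' : S = {D.start} := by
      ext q
      grind
    subst hS'
    refine ⟨[0], by simp, ?_⟩
    have h00 : D.step D.start 0 = D.start := Fin.ext (by rw [hzero, hstart]; simp)
    ext q
    simp only [DFA.starEval, List.foldl_cons, List.foldl_nil, DFA.starStep, Set.mem_singleton_iff,
      exists_eq_left, h00, Set.mem_ofPred_eq, Finset.coe_singleton]
    grind
  have hbase : ∀ S : Finset (Fin m), D.start ∈ S → S.card = k → (∃ t ∈ S, t.1 = 1) →
      ∃ u, u ≠ [] ∧ D.starEval u = S := by
    clear hne hk hS
    rintro S hS hk ⟨t, ht, hi⟩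
    let S' : Finset (Fin m) :=
      Finset.univ.filter fun q => q = D.start ∨ 2 ≤ q.1 ∧ D.step q 1 ∈ S
    have hS' : D.start ∈ S' := by simp [S']
    have h1 : D.step D.start 1 = t := Fin.ext (by rw [hone, hstart, hi]; simp)
    have hmaps : ∀ p ∈ S', D.step p 1 ∈ S := by
      intro p hp
      rcases (Finset.mem_filter.1 hp).2 with rfl | h
      · rwa [h1]
      · exact h.2
    have hcard : S'.card < k := by
      rw [← hk, ← Finset.card_erase_add_one hS, Nat.lt_add_one_iff]
      refine Finset.card_le_card_of_injOn (D.step · 1) (fun p hp => ?_) (fun p hp q hq h => ?_)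
      · refine Finset.mem_coe.2 (Finset.mem_erase.2 ⟨fun h => ?_, hmaps p hp⟩)
        have := congrArg Fin.val h
        simp only [hone, hstart] at this
        grind
      · have := congrArg Fin.val h
        have hp' := (Finset.mem_filter.1 hp).2
        have hq' := (Finset.mem_filter.1 hq).2
        simp only [hone] at this
        apply Fin.ext
        grind
    refine hlift S S' 1 (hstep _ D.start _ hS' ?_) hS hmaps (fun q hq hq0 => ?_)
      (ihk _ hcard S' hS' rfl)
    · rw [hacc, h1, hi]
    · have := hval q hq0
      by_cases hq1 : q.1 = 1
      · exact ⟨D.start, hS', h1.trans (Fin.ext (by omega))⟩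
      · let p : Fin m := ⟨if q.1 = 2 then m - 1 else q.1 - 1, by split_ifs <;> omega⟩
        have hp : D.step p 1 = q := by
          apply Fin.ext
          rw [hone]
          grind
        refine ⟨p, ?_, hp⟩
        simp only [S', Finset.mem_filter, Finset.mem_univ, true_and, hp]
        grind
  obtain ⟨t, ht, ht0⟩ := hne
  obtain ⟨i, hi⟩ : ∃ i, t.1 = i + 1 := Nat.exists_eq_succ_of_ne_zero (hval t ht0)
  clear ht0
  induction i generalizing S t with
  | zero => exact hbase S hS hk ⟨t, ht, hi⟩
  | succ i ihi =>
    by_cases hone_mem : ∃ q ∈ S, q.1 = 1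
    · exact hbase S hS hk hone_mem
    let S' : Finset (Fin m) :=
      Finset.univ.filter fun q => q = D.start ∨ q.1 + 1 < m ∧ D.step q 0 ∈ S
    have hS' : D.start ∈ S' := by simp [S']
    have h0 : D.step D.start 0 = D.start := Fin.ext (by rw [hzero, hstart]; simp)
    have hmaps : ∀ p ∈ S', D.step p 0 ∈ S := by
      intro p hp
      rcases (Finset.mem_filter.1 hp).2 with rfl | h
      · rwa [h0]
      · exact h.2
    have hcard : S'.card ≤ k := by
      rw [← hk]
      refine Finset.card_le_card_of_injOn (D.step · 0) hmaps (fun p hp q hq h => ?_)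
      have := congrArg Fin.val h
      have hp' := (Finset.mem_filter.1 hp).2
      have hq' := (Finset.mem_filter.1 hq).2
      simp only [hzero] at this
      apply Fin.ext
      grind
    have hS'reach : ∃ u, u ≠ [] ∧ D.starEval u = S' := by
      rcases hcard.lt_or_eq with h | h
      · exact ihk _ h S' hS' rfl
      · have ht' : D.step ⟨i + 1, by omega⟩ 0 = t := by
          apply Fin.ext
          rw [hzero]
          grind
        refine ihi S' hS' h ⟨i + 1, by omega⟩ ?_ rfl
        simp only [S', Finset.mem_filter, Finset.mem_univ, true_and, ht']
        grind
    refine hlift S S' 0 (hstep' _ D.start _ hS' h0) hS hmaps (fun q hq hq0 => ?_) hS'reach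
    have := hval q hq0
    have hq1 : q.1 ≠ 1 := fun h => hone_mem ⟨q, hq, h⟩
    have hp : D.step ⟨q.1 - 1, by omega⟩ 0 = q := by
      apply Fin.ext
      rw [hzero]
      grind
    refine ⟨_, ?_, hp⟩
    simp only [S', Finset.mem_filter, Finset.mem_univ, true_and, hp]
    grind

end starWitness

/-- Star lower bound: for every `n ≥ 2` there is a binary language accepted by
an `n`-state AFA such that every BFA for `L∗` has at least `2^n` states. -/
theorem star_lower (n : ℕ) (hn : 2 ≤ n) :
    ∃ L : Language (Fin 2), AcceptsAFA L n ∧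
      ∀ k : ℕ, AcceptsBFA (KStar.kstar L) k → 2 ^ n ≤ k := by
  have hm : 4 ≤ 2 ^ n := Nat.pow_le_pow_right two_pos hn
  have hme : 2 ^ n % 2 = 0 := by
    obtain ⟨k, rfl⟩ := Nat.exists_eq_add_of_le' (Nat.one_le_of_lt hn)
    simp [pow_succ]
  refine ⟨(starWitness (2 ^ n) hm).accepts.reverse, ⟨Fin n, inferInstance, Fintype.card_fin n, ?_⟩,
    ?_⟩
  · let e : Fin (2 ^ n) ≃ (Fin n → Bool) :=
      finFunctionFinEquiv.symm.trans (Equiv.arrowCongr (Equiv.refl _) finTwoEquiv)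
    rw [← DFA.accepts_reindex (starWitness (2 ^ n) hm) e]
    refine DFA.exists_afa_reverse _ ⟨0, by omega⟩ ?_
    ext v
    obtain ⟨q, rfl⟩ := e.surjective v
    have hbit : e q ⟨0, by omega⟩ = true ↔ q.1 % 2 = 1 := by
      simp [e, finFunctionFinEquiv, finTwoEquiv]
    simp [hbit, starWitness.mem_accept]
  · rintro k ⟨σ, _, rfl, A, hA⟩
    classical
    rw [BFA.language_eq_reverse, ← Language.reverse_kstar] at hA
    have h := (starWitness (2 ^ n) hm).lt_card_of_accepts_kstar
      (starWitness.start_notMem_accept hm) (starWitness.exists_starEval_eq hm)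
      (starWitness.starTests_singleton hm hme) A.toDFA_s12 (Language.reverse_injective hA)
    rw [Fintype.card_fin, Fintype.card_fun, Fintype.card_bool] at h
    have := (Nat.pow_lt_pow_iff_right one_lt_two).1 h
    omega
end

section
/- For every regular language L over a finite alphabet Σ, the minimal number of states of an alternating finite automaton accepting L equals the minimal number of states of an alternating finite automaton accepting the complement Σ* \ L. -/
namespace BFA

variable {α σ : Type}

/-- The dual automaton: every Boolean function `f` is replaced by
`v ↦ ¬ f (¬ v)` and the finality vector is negated. -/
def dual (A : BFA α σ) : BFA α σ where
  δ q a v := !A.δ q a fun p => !v p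
  g v := !A.g fun p => !v p
  accept q := !A.accept q

theorem foldl_stepFn_dual (A : BFA α σ) (w : List α) (h : (σ → Bool) → Bool) :
    w.foldl A.dual.stepFn (fun v => !h fun p => !v p) =
      fun v => !w.foldl A.stepFn h fun p => !v p := by
  induction w generalizing h with
  | nil => rfl
  | cons a w ih =>
    rw [List.foldl_cons, List.foldl_cons, ← ih]
    congr 1
    funext v
    simp [stepFn, dual]

theorem language_dual (A : BFA α σ) : A.dual.language = A.languageᶜ := by
  ext w
  have h := congrFun (A.foldl_stepFn_dual w A.g) A.dual.accept
  change A.dual.eval w A.dual.accept = !A.eval w (fun p => !A.dual.accept p) at h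
  change A.dual.eval w A.dual.accept = true ↔ ¬ A.eval w A.accept = true
  rw [h]
  simp [dual]

theorem IsAFA.dual {A : BFA α σ} (hA : A.IsAFA) : A.dual.IsAFA := by
  obtain ⟨q₀, h⟩ := hA
  exact ⟨q₀, by simp [BFA.dual, h]⟩

end BFA

theorem AcceptsAFA.compl {α : Type} {L : Language α} {n : ℕ} (h : AcceptsAFA L n) :
    AcceptsAFA Lᶜ n := by
  obtain ⟨σ, hσ, hn, A, hA, rfl⟩ := h
  exact ⟨σ, hσ, hn, A.dual, hA.dual, A.language_dual⟩

/-- For every regular language `L`, the minimal number of states of an AFA for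
`L` equals the minimal number of states of an AFA for the complement of `L`. -/
theorem afa_complement_complexity (α : Type) [Fintype α] (L : Language α)
    (hreg : ∃ (σ : Type) (_ : Fintype σ) (D : DFA α σ), D.accepts = L) :
    sInf {n : ℕ | AcceptsAFA L n} = sInf {n : ℕ | AcceptsAFA Lᶜ n} := by
  congr 1
  ext n
  exact ⟨AcceptsAFA.compl, fun h => compl_compl L ▸ h.compl⟩
end

section
/- Let K and L be languages over a finite alphabet Σ accepted by an m-state Boolean finite automaton and an n-state Boolean finite automaton, respectively. Then the union K ∪ L, the intersection K ∩ L, the difference K \ L, and the symmetric difference (K \ L) ∪ (L \ K) are each accepted by a Boolean finite automaton with at most m + n states. -/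
namespace BFA

variable {α σ τ : Type}

/-- The disjoint union of two BFAs, started in a Boolean combination `op` of the two initial
functions. -/
def combine (op : Bool → Bool → Bool) (A : BFA α σ) (B : BFA α τ) : BFA α (σ ⊕ τ) where
  δ := Sum.elim (fun q a v => A.δ q a (v ∘ Sum.inl)) (fun q a v => B.δ q a (v ∘ Sum.inr))
  g v := op (A.g (v ∘ Sum.inl)) (B.g (v ∘ Sum.inr))
  accept := Sum.elim A.accept B.accept

theorem foldl_stepFn_combine (op : Bool → Bool → Bool) (A : BFA α σ) (B : BFA α τ) (w : List α)
    (h : (σ → Bool) → Bool) (h' : (τ → Bool) → Bool) :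
    w.foldl (combine op A B).stepFn (fun v => op (h (v ∘ Sum.inl)) (h' (v ∘ Sum.inr))) =
      fun v => op (w.foldl A.stepFn h (v ∘ Sum.inl)) (w.foldl B.stepFn h' (v ∘ Sum.inr)) := by
  induction w generalizing h h' with
  | nil => rfl
  | cons a w ih => exact ih (A.stepFn h a) (B.stepFn h' a)

theorem eval_combine_accept (A : BFA α σ) (op : Bool → Bool → Bool) (B : BFA α τ) (w : List α) :
    (combine op A B).eval w (combine op A B).accept =
      op (A.eval w A.accept) (B.eval w B.accept) :=
  congrFun (foldl_stepFn_combine op A B w A.g B.g) _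

end BFA

/-- Any language that is a Boolean combination of two BFA languages is accepted by a BFA whose
number of states is the sum of theirs. -/
theorem AcceptsBFA.combine {α : Type} {K L M : Language α} {m n : ℕ} (hK : AcceptsBFA K m)
    (hL : AcceptsBFA L n) (op : Bool → Bool → Bool)
    (hM : ∀ (w : List α) (b c : Bool), (b = true ↔ w ∈ K) → (c = true ↔ w ∈ L) →
      (op b c = true ↔ w ∈ M)) :
    AcceptsBFA M (m + n) := by
  obtain ⟨σ, _, rfl, A, rfl⟩ := hK
  obtain ⟨τ, _, rfl, B, rfl⟩ := hL
  refine ⟨σ ⊕ τ, inferInstance, Fintype.card_sum, A.combine op B, Set.ext fun w => ?_⟩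
  exact (Bool.eq_iff_iff.1 (BFA.eval_combine_accept A op B w)).trans
    (hM w (A.eval w A.accept) (B.eval w B.accept) Iff.rfl Iff.rfl)

/-- Boolean operations on BFAs, upper bounds: union, intersection, difference
and symmetric difference of an `m`-state and an `n`-state BFA language are each
accepted by a BFA with at most `m + n` states. (For languages, `⊔` is union
and `⊓` is intersection.) -/
theorem bfa_boolean_ops_upper (α : Type) [Fintype α] (K L : Language α) (m n : ℕ)
    (hK : AcceptsBFA K m) (hL : AcceptsBFA L n) :
    (∃ k ≤ m + n, AcceptsBFA (K ⊔ L) k) ∧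
    (∃ k ≤ m + n, AcceptsBFA (K ⊓ L) k) ∧
    (∃ k ≤ m + n, AcceptsBFA (K \ L) k) ∧
    (∃ k ≤ m + n, AcceptsBFA ((K \ L) ⊔ (L \ K)) k) := by
  refine ⟨⟨_, le_rfl, hK.combine hL (fun b c => b || c) fun w b c hb hc => ?_⟩,
    ⟨_, le_rfl, hK.combine hL (fun b c => b && c) fun w b c hb hc => ?_⟩,
    ⟨_, le_rfl, hK.combine hL (fun b c => b && !c) fun w b c hb hc => ?_⟩,
    ⟨_, le_rfl, hK.combine hL (fun b c => b ^^ c) fun w b c hb hc => ?_⟩⟩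
  · change _ ↔ w ∈ K ∨ w ∈ L
    simp [← hb, ← hc]
  · change _ ↔ w ∈ K ∧ w ∈ L
    simp [← hb, ← hc]
  · change _ ↔ w ∈ K ∧ w ∉ L
    simp [← hb, ← hc]
  · change _ ↔ (w ∈ K ∧ w ∉ L) ∨ (w ∈ L ∧ w ∉ K)
    rw [← hb, ← hc]
    cases b <;> cases c <;> simp
end

section
/- For all m, n ≥ 2 there exist languages K and L over a one-letter alphabet such that K is accepted by an m-state Boolean finite automaton, L is accepted by an n-state Boolean finite automaton, and every Boolean finite automaton accepting the union K ∪ L has at least m + n states. -/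
/-- The transition map on state vectors of a BFA over a one-letter alphabet. -/
def BFA.unaryStep {σ : Type} (A : BFA (Fin 1) σ) (v : σ → Bool) : σ → Bool :=
  fun q => A.δ q 0 v

theorem BFA.foldl_stepFn_unary {σ : Type} (A : BFA (Fin 1) σ) (w : List (Fin 1))
    (h : (σ → Bool) → Bool) (v : σ → Bool) :
    w.foldl A.stepFn h v = h (A.unaryStep^[w.length] v) := by
  induction w generalizing h with
  | nil => rfl
  | cons a w ih =>
    rw [List.foldl_cons, ih, List.length_cons, Function.iterate_succ_apply',
      Subsingleton.elim a 0]
    rfl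

theorem BFA.mem_language_unary {σ : Type} (A : BFA (Fin 1) σ) (w : List (Fin 1)) :
    w ∈ A.language ↔ A.g (A.unaryStep^[w.length] A.accept) = true := by
  rw [← A.foldl_stepFn_unary w A.g]
  rfl

/-- The unary language of all words whose length is a multiple of `p`. -/
def lengthMultiples (p : ℕ) : Language (Fin 1) :=
  { w | p ∣ w.length }

theorem acceptsBFA_lengthMultiples {p m : ℕ} (hp : 0 < p) (hpm : p ≤ 2 ^ m) :
    AcceptsBFA (lengthMultiples p) m := by
  have : NeZero p := ⟨hp.ne'⟩
  obtain ⟨e⟩ : Nonempty (ZMod p ↪ (Fin m → Bool)) :=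
    Function.Embedding.nonempty_of_card_le (by simpa [ZMod.card] using hpm)
  have he : Function.LeftInverse (Function.invFun e) e :=
    Function.leftInverse_invFun e.injective
  let A : BFA (Fin 1) (Fin m) :=
    { δ := fun q _ v => e (Function.invFun e v + 1) q
      g := fun v => decide (Function.invFun e v = 0)
      accept := e 0 }
  have hA : ∀ i : ℕ, A.unaryStep^[i] A.accept = e i := by
    intro i
    induction i with
    | zero => simp [A]
    | succ i ih =>
      rw [Function.iterate_succ_apply', ih]
      change e (Function.invFun e (e i) + 1) = _
      rw [he]
      push_cast
      rfl
  refine ⟨Fin m, inferInstance, Fintype.card_fin m, A, ?_⟩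
  ext w
  rw [A.mem_language_unary, hA]
  change decide (Function.invFun e (e _) = 0) = true ↔ p ∣ w.length
  rw [he, decide_eq_true_iff, ZMod.natCast_eq_zero_iff]

/-- Membership in the language of a `k`-state unary BFA is ultimately periodic with a period
of at most `2 ^ k`. -/
theorem AcceptsBFA.exists_period {L : Language (Fin 1)} {k : ℕ} (hL : AcceptsBFA L k) :
    ∃ N d : ℕ, 0 < d ∧ d ≤ 2 ^ k ∧
      ∀ t, N ≤ t → (List.replicate (t + d) 0 ∈ L ↔ List.replicate t 0 ∈ L) := by
  obtain ⟨σ, _, hk, A, rfl⟩ := hL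
  classical
  have hcard : Fintype.card (σ → Bool) < Fintype.card (Fin (2 ^ k + 1)) := by
    simp [hk]
  obtain ⟨i, j, hne, hij⟩ := Fintype.exists_ne_map_eq_of_card_lt
    (fun i : Fin (2 ^ k + 1) => A.unaryStep^[i] A.accept) hcard
  wlog hlt : i < j generalizing i j
  · exact this j i hne.symm hij.symm (lt_of_le_of_ne (not_lt.mp hlt) hne.symm)
  refine ⟨i, j - i, by omega, by omega, fun t ht => ?_⟩
  obtain ⟨s, rfl⟩ := Nat.exists_eq_add_of_le' ht
  have hs : s + i + (j - i : ℕ) = s + j := by omega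
  rw [A.mem_language_unary, A.mem_language_unary, List.length_replicate,
    List.length_replicate, hs, Function.iterate_add_apply, Function.iterate_add_apply]
  rw [hij]

/-- An ultimate period of the set of multiples of `p` or `q`, with `p` and `q` coprime and
`q ≠ 1`, is a multiple of `p`. -/
theorem dvd_of_ultimate_period {p q N d : ℕ} (hp : 0 < p) (hq : 2 ≤ q) (hpq : p.Coprime q)
    (h : ∀ t, N ≤ t → (p ∣ t + d ∨ q ∣ t + d ↔ p ∣ t ∨ q ∣ t)) : p ∣ d := by
  obtain ⟨x, hxp, hxq⟩ := Nat.chineseRemainder hpq 0 (1 + (q - 1) * d)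
  have hp_dvd : p ∣ x + p * q * N :=
    dvd_add ((Nat.modEq_zero_iff_dvd).mp hxp) ⟨q * N, by ring⟩
  have hN : N ≤ x + p * q * N :=
    (Nat.le_mul_of_pos_left N (by positivity)).trans (Nat.le_add_left _ _)
  have hq_not : ¬ q ∣ x + p * q * N + d := by
    intro hdvd
    have h_one : x + p * q * N + d ≡ 1 [MOD q] := by
      have h_mul : p * q * N ≡ 0 [MOD q] := (Nat.modEq_zero_iff_dvd).mpr ⟨p * N, by ring⟩
      have h_sum := (hxq.add h_mul).add_right d
      have h_eq : 1 + (q - 1) * d + 0 + d = 1 + q * d := by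
        obtain ⟨r, rfl⟩ := Nat.exists_eq_add_of_le' hq
        simp only [show r + 2 - 1 = r + 1 by omega]
        ring
      rw [h_eq] at h_sum
      exact h_sum.trans (by simp [Nat.ModEq])
    have h_dvd_one : q ∣ 1 := (h_one.dvd_iff dvd_rfl).mp hdvd
    have := Nat.le_of_dvd one_pos h_dvd_one
    omega
  exact (Nat.dvd_add_right hp_dvd).mp (((h _ hN).mpr (Or.inl hp_dvd)).resolve_right hq_not)

theorem AcceptsBFA.mul_le_two_pow {p q k : ℕ} (hp : 2 ≤ p) (hq : 2 ≤ q) (hpq : p.Coprime q)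
    (h : AcceptsBFA (lengthMultiples p ⊔ lengthMultiples q) k) : p * q ≤ 2 ^ k := by
  obtain ⟨N, d, hd, hdk, hper⟩ := h.exists_period
  have hmem : ∀ t : ℕ, (List.replicate t (0 : Fin 1) ∈ lengthMultiples p ⊔ lengthMultiples q) ↔
      p ∣ t ∨ q ∣ t := by
    intro t
    change p ∣ (List.replicate t (0 : Fin 1)).length ∨
      q ∣ (List.replicate t (0 : Fin 1)).length ↔ _
    rw [List.length_replicate]
  simp only [hmem] at hper
  have hpd : p ∣ d := dvd_of_ultimate_period (by omega) hq hpq hper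
  have hqd : q ∣ d := dvd_of_ultimate_period (by omega) hp hpq.symm fun t ht => by
    rw [or_comm, hper t ht, or_comm]
  exact (Nat.le_of_dvd hd (hpq.mul_dvd_of_dvd_of_dvd hpd hqd)).trans hdk

/-- Union on BFAs, lower bound: for all `m, n ≥ 2` there are unary languages
`K`, `L` accepted by an `m`-state and an `n`-state BFA such that every BFA for
`K ∪ L` has at least `m + n` states. (For languages, `⊔` is union.) -/
theorem bfa_union_lower (m n : ℕ) (hm : 2 ≤ m) (hn : 2 ≤ n) :
    ∃ K L : Language (Fin 1), AcceptsBFA K m ∧ AcceptsBFA L n ∧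
      ∀ k : ℕ, AcceptsBFA (K ⊔ L) k → m + n ≤ k := by
  have h_four : ∀ r, 2 ≤ r → 4 ≤ 2 ^ r := fun r hr =>
    (Nat.pow_le_pow_right two_pos hr : 2 ^ 2 ≤ 2 ^ r)
  have h_m := h_four m hm
  have h_n := h_four n hn
  have h_coprime : (2 ^ m).Coprime (2 ^ n - 1) := by
    refine Nat.Coprime.pow_left m (Nat.coprime_two_left.mpr ?_)
    exact Nat.Even.sub_odd (by omega) (Nat.even_pow.mpr ⟨even_two, by omega⟩) odd_one
  refine ⟨lengthMultiples (2 ^ m), lengthMultiples (2 ^ n - 1),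
    acceptsBFA_lengthMultiples (by omega) le_rfl,
    acceptsBFA_lengthMultiples (by omega) (Nat.sub_le _ _), fun k hk => ?_⟩
  have h_le := hk.mul_le_two_pow (by omega) (by omega) h_coprime
  by_contra! h_lt
  have h_pow : 2 ^ (k + 1) ≤ 2 ^ m * 2 ^ n := by
    rw [← pow_add]
    exact Nat.pow_le_pow_right two_pos h_lt
  rw [pow_succ] at h_pow
  rw [Nat.mul_sub, mul_one] at h_le
  have h_mul : 2 ^ m * 4 ≤ 2 ^ m * 2 ^ n := Nat.mul_le_mul_left _ h_n
  omega
end
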